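/- arXiv:1609.05386 — 4 statements merged into one kernel-verified Lean document; each statement's English description precedes it below -/
import Mathlib

section
/- Let n be an odd squarefree positive integer and let D be an integer with D ≡ 0 or 1 (mod 4) and gcd(D, n) = 1. Then ∑_{d ∣ n} (−2)^{ω(n/d)} · r(D, d) = ∏_{p ∣ n} ( (D/p) − 1 ), where the sum runs over positive divisors d of n, the product runs over the prime divisors p of n, and (D/p) is the Legendre symbol. In particular, the sum equals (−2)^{ω(n)} if (D/p) = −1 for all primes p ∣ n, and equals 0 otherwise. -/
/-- For a positive integer `n`, `ω n` is the number of distinct prime divisors of `n`. -/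
def ω (n : ℕ) : ℕ := n.primeFactors.card

/-- `r D n` is the number of residues `r` modulo `2n` with `r² ≡ D (mod 4n)`. -/
def r (D : ℤ) (n : ℕ) : ℕ :=
  ((Finset.range (2 * n)).filter (fun x : ℕ => ((x : ℤ) ^ 2) % (4 * n) = D % (4 * n))).card

open Finset

/-- For odd `n` and a discriminant `D`, the residues counted by `r D n` correspond to the
square roots of `D` modulo `n`. -/
theorem r_eq_card_sqrts {D : ℤ} (hD : D % 4 = 0 ∨ D % 4 = 1) {n : ℕ} (hn : Odd n) :
    r D n = Nat.card {y : ZMod n // y ^ 2 = (D : ZMod n)} := by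
  have hpos : 0 < n := hn.pos
  have : NeZero n := ⟨hpos.ne'⟩
  have hmod : ∀ x : ℕ, ((x : ℤ) ^ 2) % (4 * n) = D % (4 * n) ↔
      (x : ℤ) % 2 = D % 2 ∧ (x : ZMod n) ^ 2 = (D : ZMod n) := by
    intro x
    have h4 : IsCoprime (4 : ℤ) n := by
      rw [show (4 : ℤ) = ((4 : ℕ) : ℤ) from rfl, Nat.isCoprime_iff_coprime]
      exact Nat.Coprime.pow_left 2 (Nat.coprime_two_left.mpr hn)
    have hpar : (x : ℤ) ^ 2 % 4 = D % 4 ↔ (x : ℤ) % 2 = D % 2 := by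
      rcases Int.even_or_odd' (x : ℤ) with ⟨k, hk | hk⟩ <;> rw [hk] <;> ring_nf <;> omega
    have hz : (x : ZMod n) ^ 2 = (D : ZMod n) ↔ (x : ℤ) ^ 2 ≡ D [ZMOD n] := by
      rw [← ZMod.intCast_eq_intCast_iff]
      push_cast
      rfl
    rw [hz, ← hpar]
    change (x : ℤ) ^ 2 ≡ D [ZMOD 4 * n] ↔ (x : ℤ) ^ 2 ≡ D [ZMOD 4] ∧ _
    rw [Int.modEq_and_modEq_iff_modEq_mul (Int.isCoprime_iff_gcd_eq_one.mp h4)]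
  rw [Nat.card_eq_fintype_card, Fintype.card_subtype, r]
  refine card_nbij (fun x : ℕ => (x : ZMod n)) ?_ ?_ ?_
  · intro x hx
    simp only [coe_filter, mem_range, Set.mem_ofPred_eq, hmod, mem_univ,
      true_and] at hx ⊢
    exact hx.2.2
  · intro x hx y hy hxy
    simp only [coe_filter, mem_range, Set.mem_ofPred_eq, hmod] at hx hy
    have h1 : x ≡ y [MOD n] := (ZMod.natCast_eq_natCast_iff _ _ _).mp hxy
    have h2 : x ≡ y [MOD 2] := by
      have := hx.2.1.trans hy.2.1.symm
      unfold Nat.ModEq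
      omega
    have h3 : x ≡ y [MOD 2 * n] :=
      (Nat.modEq_and_modEq_iff_modEq_mul (Nat.coprime_two_left.mpr hn)).mp ⟨h2, h1⟩
    exact h3.eq_of_lt_of_lt hx.1 hy.1
  · intro y hy
    simp only [coe_filter, mem_univ, true_and, Set.mem_ofPred_eq] at hy
    have hlt := ZMod.val_lt y
    have hn2 : n % 2 = 1 := Nat.odd_iff.mp hn
    simp only [Set.mem_image, coe_filter, mem_range, Set.mem_ofPred_eq, hmod]
    by_cases h : (y.val : ℤ) % 2 = D % 2
    · exact ⟨y.val, ⟨by omega, h, by simpa using hy⟩, by simp⟩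
    · exact ⟨y.val + n, ⟨by omega, by push_cast; omega, by simpa using hy⟩, by simp⟩

theorem card_sqrts_mul (D : ℤ) {m n : ℕ} (h : m.Coprime n) :
    Nat.card {y : ZMod (m * n) // y ^ 2 = (D : ZMod (m * n))} =
      Nat.card {y : ZMod m // y ^ 2 = (D : ZMod m)} *
        Nat.card {y : ZMod n // y ^ 2 = (D : ZMod n)} := by
  rw [← Nat.card_prod]
  refine Nat.card_congr (Equiv.trans (Equiv.subtypeEquiv (ZMod.chineseRemainder h).toEquiv ?_)
    (Equiv.subtypeProdEquivProd
      (p := fun y : ZMod m => y ^ 2 = (D : ZMod m)) (q := fun y : ZMod n => y ^ 2 = (D : ZMod n))))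
  intro y
  rw [← (ZMod.chineseRemainder h).injective.eq_iff]
  simp [Prod.ext_iff]

theorem card_sqrts_prod_primes (D : ℤ) (s : Finset ℕ) (hs : ∀ p ∈ s, p.Prime ∧ p ≠ 2) :
    (Nat.card {y : ZMod (∏ p ∈ s, p) // y ^ 2 = (D : ZMod (∏ p ∈ s, p))} : ℤ) =
      ∏ p ∈ s, (jacobiSym D p + 1) := by
  induction s using Finset.induction_on with
  | empty =>
    have : Subsingleton (ZMod (∏ p ∈ (∅ : Finset ℕ), p)) := by
      rw [prod_empty]; infer_instance
    have : Nonempty {y : ZMod (∏ p ∈ (∅ : Finset ℕ), p) // y ^ 2 = D} :=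
      ⟨⟨0, Subsingleton.elim _ _⟩⟩
    rw [Nat.card_unique]
    simp
  | insert p s hps ih =>
    obtain ⟨hp, hp2⟩ := hs p (mem_insert_self p s)
    have hs' : ∀ q ∈ s, q.Prime ∧ q ≠ 2 := fun q hq => hs q (mem_insert_of_mem hq)
    have hcop : p.Coprime (∏ q ∈ s, q) := Nat.Coprime.prod_right fun q hq =>
      (Nat.coprime_primes hp (hs' q hq).1).mpr fun h => hps (h ▸ hq)
    have : Fact p.Prime := ⟨hp⟩
    rw [prod_insert hps, prod_insert hps, card_sqrts_mul D hcop, Nat.cast_mul, ih hs',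
      ← jacobiSym.legendreSym.to_jacobiSym, ← legendreSym.card_sqrts p hp2 D,
      Nat.card_eq_fintype_card, Fintype.card_subtype]
    simp

theorem r_eq_prod_jacobiSym_add_one {D : ℤ} (hD : D % 4 = 0 ∨ D % 4 = 1) {n : ℕ} (hn : Odd n)
    (hsf : Squarefree n) : (r D n : ℤ) = ∏ p ∈ n.primeFactors, (jacobiSym D p + 1) := by
  rw [r_eq_card_sqrts hD hn, ← card_sqrts_prod_primes D n.primeFactors,
    Nat.prod_primeFactors_of_squarefree hsf]
  intro p hp
  refine ⟨Nat.prime_of_mem_primeFactors hp, ?_⟩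
  rintro rfl
  exact Nat.not_even_iff_odd.mpr hn (even_iff_two_dvd.mpr (Nat.dvd_of_mem_primeFactors hp))

/-- For odd squarefree `n` and a discriminant `D` prime to `n`,
`∑_{d ∣ n} (-2)^{ω(n/d)} r(D, d) = ∏_{p ∣ n} ((D/p) - 1)`; in particular the sum is
`(-2)^{ω(n)}` if `(D/p) = -1` for all primes `p ∣ n`, and `0` otherwise.  (For odd
primes `p`, the Legendre symbol `(D/p)` coincides with the Jacobi symbol `J(D | p)`.) -/
theorem sum_neg_two_pow_omega_mul_r (n : ℕ) (hn : 0 < n) (hodd : Odd n)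
    (hsf : Squarefree n) (D : ℤ) (hD : D % 4 = 0 ∨ D % 4 = 1) (hcop : Int.gcd D n = 1) :
    (∑ d ∈ n.divisors, (-2 : ℤ) ^ ω (n / d) * (r D d : ℤ)
      = ∏ p ∈ n.primeFactors, (jacobiSym D p - 1))
    ∧ ((∀ p ∈ n.primeFactors, jacobiSym D p = -1) →
        ∑ d ∈ n.divisors, (-2 : ℤ) ^ ω (n / d) * (r D d : ℤ) = (-2 : ℤ) ^ ω n)
    ∧ ((¬ ∀ p ∈ n.primeFactors, jacobiSym D p = -1) →
        ∑ d ∈ n.divisors, (-2 : ℤ) ^ ω (n / d) * (r D d : ℤ) = 0) := by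
  have hmain : ∑ d ∈ n.divisors, (-2 : ℤ) ^ ω (n / d) * (r D d : ℤ)
      = ∏ p ∈ n.primeFactors, (jacobiSym D p - 1) := by
    have hprod : ∀ t ⊆ n.primeFactors, (∏ p ∈ t, p).primeFactors = t := fun t ht =>
      Nat.primeFactors_prod fun p hp => Nat.prime_of_mem_primeFactors (ht hp)
    have hexpand : ∀ p, jacobiSym D p - 1 = (jacobiSym D p + 1) + (-2) := fun p => by ring
    have hfactors : (UniqueFactorizationMonoid.normalizedFactors n).toFinset = n.primeFactors := by
      rw [Nat.factors_eq]
      rfl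
    simp_rw [hexpand]
    rw [prod_add, ← Nat.divisors_filter_squarefree_of_squarefree hsf,
      Nat.sum_divisors_filter_squarefree hsf.ne_zero, hfactors]
    refine sum_congr rfl fun t ht => ?_
    have ht' := mem_powerset.mp ht
    have hdvd : ∏ p ∈ t, p ∣ n :=
      (prod_dvd_prod_of_subset _ _ _ ht').trans (Nat.prod_primeFactors_dvd n)
    rw [prod_val, Function.id_def, ω, ← Nat.prod_primeFactors_sdiff_of_squarefree hsf ht',
      hprod _ sdiff_subset, r_eq_prod_jacobiSym_add_one hD (hodd.of_dvd_nat hdvd)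
        (hsf.squarefree_of_dvd hdvd), hprod t ht', prod_const, mul_comm]
  rw [hmain]
  refine ⟨rfl, fun h => ?_, fun h => ?_⟩
  · rw [ω, ← prod_const]
    exact prod_congr rfl fun p hp => by rw [h p hp]; norm_num
  · push Not at h
    obtain ⟨p, hp, hne⟩ := h
    refine prod_eq_zero hp (sub_eq_zero.mpr ?_)
    refine (jacobiSym.eq_one_or_neg_one ?_).resolve_right hne
    exact Nat.dvd_one.mp (hcop ▸ Int.gcd_dvd_gcd_of_dvd_right D
      (Int.natCast_dvd_natCast.mpr (Nat.dvd_of_mem_primeFactors hp)))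
end

section
/- Let D be an integer with D ≡ 0 or 1 (mod 4), and let m, n be coprime positive integers. Then r(D, m·n) = r(D, m) · r(D, n), i.e., r(D, ·) is multiplicative in its second argument. -/
/-- The residues modulo `2n` counted by `r D n`. -/
def sqrtResidues (D : ℤ) (n : ℕ) : Finset ℕ :=
  (Finset.range (2 * n)).filter (fun x : ℕ => ((x : ℤ) ^ 2) % (4 * n) = D % (4 * n))

theorem mem_sqrtResidues {D : ℤ} {n x : ℕ} :
    x ∈ sqrtResidues D n ↔ x < 2 * n ∧ (4 * n : ℤ) ∣ (x : ℤ) ^ 2 - D := by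
  rw [sqrtResidues, Finset.mem_filter, Finset.mem_range, Int.emod_eq_emod_iff_emod_sub_eq_zero,
    Int.dvd_iff_emod_eq_zero]

/-- Whether `x ^ 2 ≡ D (mod 4n)` depends only on `x` modulo `2n`. -/
theorem dvd_sq_sub_of_modEq {D : ℤ} {n x y : ℕ} (h : x ≡ y [MOD 2 * n])
    (hy : (4 * n : ℤ) ∣ (y : ℤ) ^ 2 - D) : (4 * n : ℤ) ∣ (x : ℤ) ^ 2 - D := by
  obtain ⟨k, hk⟩ := Nat.modEq_iff_dvd.mp h
  obtain ⟨l, hl⟩ := hy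
  push_cast at hk
  refine ⟨l - y * k + n * k ^ 2, ?_⟩
  have hx : (x : ℤ) = y - 2 * n * k := by linarith
  rw [hx]
  linear_combination hl

/-- Two square roots of `D` modulo `4` have the same parity. -/
theorem modEq_two_of_four_dvd {D : ℤ} {x y : ℕ} (hx : (4 : ℤ) ∣ (x : ℤ) ^ 2 - D)
    (hy : (4 : ℤ) ∣ (y : ℤ) ^ 2 - D) : x ≡ y [MOD 2] := by
  have h : (2 : ℤ) ∣ (y : ℤ) ^ 2 - (x : ℤ) ^ 2 := by omega
  have h' : Even ((y : ℤ) ^ 2 - (x : ℤ) ^ 2) := even_iff_two_dvd.mpr h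
  rw [Nat.modEq_iff_dvd, Nat.cast_ofNat, ← even_iff_two_dvd]
  simpa [Int.even_sub, Int.even_pow] using h'

theorem mod_mem_sqrtResidues {D : ℤ} {n x : ℕ} (hn : 0 < n)
    (hx : (4 * n : ℤ) ∣ (x : ℤ) ^ 2 - D) : x % (2 * n) ∈ sqrtResidues D n :=
  mem_sqrtResidues.mpr
    ⟨Nat.mod_lt _ (by positivity), dvd_sq_sub_of_modEq (Nat.mod_modEq _ _) hx⟩

theorem four_mul_dvd_of_coprime {m n : ℕ} (hcop : Nat.Coprime m n) {z : ℤ}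
    (hm : (4 * m : ℤ) ∣ z) (hn : (4 * n : ℤ) ∣ z) : (4 * (m * n : ℕ) : ℤ) ∣ z := by
  obtain ⟨k, rfl⟩ := dvd_of_mul_right_dvd hm
  rw [mul_dvd_mul_iff_left (by norm_num)] at hm hn ⊢
  push_cast
  exact (Nat.isCoprime_iff_coprime.mpr hcop).mul_dvd hm hn

theorem modEq_two_mul_of_coprime {m n x y : ℕ} (hcop : Nat.Coprime m n)
    (hm : x ≡ y [MOD 2 * m]) (hn : x ≡ y [MOD 2 * n]) : x ≡ y [MOD 2 * (m * n)] := by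
  rw [Nat.modEq_iff_dvd] at hm hn ⊢
  push_cast at hm hn ⊢
  obtain ⟨k, hk⟩ := dvd_of_mul_right_dvd hm
  rw [hk] at hm hn ⊢
  rw [mul_dvd_mul_iff_left (by norm_num)] at hm hn ⊢
  exact (Nat.isCoprime_iff_coprime.mpr hcop).mul_dvd hm hn

/-- For a discriminant `D`, the function `r(D, ·)` is multiplicative:
if `m` and `n` are coprime positive integers then `r(D, mn) = r(D, m) r(D, n)`. -/
theorem r_multiplicative (D : ℤ) (hD : D % 4 = 0 ∨ D % 4 = 1) (m n : ℕ)
    (hm : 0 < m) (hn : 0 < n) (hcop : Nat.Coprime m n) :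
    r D (m * n) = r D m * r D n := by
  change (sqrtResidues D (m * n)).card = (sqrtResidues D m).card * (sqrtResidues D n).card
  rw [← Finset.card_product]
  refine Finset.card_bij (fun x _ => (x % (2 * m), x % (2 * n))) ?_ ?_ ?_
  · intro x hx
    obtain ⟨-, hx⟩ := mem_sqrtResidues.mp hx
    push_cast at hx
    exact Finset.mem_product.mpr
      ⟨mod_mem_sqrtResidues hm ((Dvd.intro (n : ℤ) (by ring)).trans hx),
        mod_mem_sqrtResidues hn ((Dvd.intro (m : ℤ) (by ring)).trans hx)⟩
  · intro x hx y hy hxy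
    obtain ⟨h₁, h₂⟩ := Prod.mk.inj hxy
    exact (modEq_two_mul_of_coprime hcop h₁ h₂).eq_of_lt_of_lt
      (mem_sqrtResidues.mp hx).1 (mem_sqrtResidues.mp hy).1
  · rintro ⟨a, b⟩ hab
    obtain ⟨ha, hb⟩ := Finset.mem_product.mp hab
    obtain ⟨ha_lt, ha⟩ := mem_sqrtResidues.mp ha
    obtain ⟨hb_lt, hb⟩ := mem_sqrtResidues.mp hb
    have hgcd : a ≡ b [MOD Nat.gcd (2 * m) (2 * n)] := by
      rw [Nat.gcd_mul_left, hcop.gcd_eq_one, mul_one]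
      exact modEq_two_of_four_dvd (dvd_of_mul_right_dvd ha) (dvd_of_mul_right_dvd hb)
    obtain ⟨x, hxa, hxb⟩ := Nat.chineseRemainder' hgcd
    refine ⟨x % (2 * (m * n)), mod_mem_sqrtResidues (Nat.mul_pos hm hn)
      (four_mul_dvd_of_coprime hcop (dvd_sq_sub_of_modEq hxa ha) (dvd_sq_sub_of_modEq hxb hb)), ?_⟩
    rw [Nat.mod_mod_of_dvd _ (Dvd.intro n (by ring)), Nat.mod_mod_of_dvd _ (Dvd.intro m (by ring)),
      hxa, hxb, Nat.mod_eq_of_lt ha_lt, Nat.mod_eq_of_lt hb_lt]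
end

section
/- Let M be a positive integer with M ≡ 3 (mod 4), and let n be a squarefree positive integer coprime to M. Write n_odd for the odd part of n. Then r(−4M, n) = r(−M, n_odd). -/
theorem r_neg_natCast (D n : ℕ) :
    r (-(D : ℤ)) n = {x ∈ Finset.range (2 * n) | 4 * n ∣ x ^ 2 + D}.card := by
  unfold r
  congr 1
  refine Finset.filter_congr fun x _ => ?_
  rw [← Int.ModEq, Int.modEq_comm, Int.modEq_iff_dvd, sub_neg_eq_add]
  exact_mod_cast Iff.rfl

theorem r_neg_four_mul_natCast (M n : ℕ) :
    r (-(4 * M) : ℤ) n = {y ∈ Finset.range n | n ∣ y ^ 2 + M}.card := by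
  have h := r_neg_natCast (4 * M) n
  push_cast at h
  rw [h]
  have key (y : ℕ) : 4 * n ∣ (2 * y) ^ 2 + 4 * M ↔ n ∣ y ^ 2 + M := by
    rw [show (2 * y) ^ 2 + 4 * M = 4 * (y ^ 2 + M) by ring]
    exact Nat.mul_dvd_mul_iff_left (by norm_num)
  symm
  refine Finset.card_bij (fun y _ => 2 * y) ?_ (fun a _ b _ hab => by lia) ?_
  · intro y hy
    rw [Finset.mem_filter, Finset.mem_range] at hy ⊢
    exact ⟨by lia, (key y).2 hy.2⟩
  · intro x hx
    rw [Finset.mem_filter, Finset.mem_range] at hx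
    have hev : Even (x ^ 2) := by
      have h2 : 2 ∣ x ^ 2 + 4 * M := dvd_trans ⟨2 * n, by ring⟩ hx.2
      rw [even_iff_two_dvd]
      lia
    obtain ⟨y, rfl⟩ := even_iff_two_dvd.1 (Nat.even_pow.1 hev).1
    refine ⟨y, ?_, rfl⟩
    rw [Finset.mem_filter, Finset.mem_range]
    exact ⟨by lia, (key y).1 hx.2⟩

theorem four_dvd_sq_add_iff_odd {M : ℕ} (hM4 : M % 4 = 3) (x : ℕ) :
    4 ∣ x ^ 2 + M ↔ Odd x := by
  rcases Nat.even_or_odd' x with ⟨k, rfl | rfl⟩ <;> ring_nf <;> grind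

theorem mul_dvd_iff_of_coprime {a b c : ℕ} (h : Nat.Coprime a b) :
    a * b ∣ c ↔ a ∣ c ∧ b ∣ c :=
  ⟨fun hd => ⟨dvd_of_mul_right_dvd hd, dvd_of_mul_left_dvd hd⟩,
    fun hd => h.mul_dvd_of_dvd_of_dvd hd.1 hd.2⟩

theorem four_mul_dvd_sq_add_iff {M m : ℕ} (hM4 : M % 4 = 3) (hm : Odd m) (x : ℕ) :
    4 * m ∣ x ^ 2 + M ↔ Odd x ∧ m ∣ x ^ 2 + M := by
  have hc : Nat.Coprime 4 m := Nat.Coprime.pow_left 2 (Nat.coprime_two_left.2 hm)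
  rw [← four_dvd_sq_add_iff_odd hM4 x]
  exact mul_dvd_iff_of_coprime hc

theorem two_mul_dvd_sq_add_iff {M m : ℕ} (hM : Odd M) (hm : Odd m) (x : ℕ) :
    2 * m ∣ x ^ 2 + M ↔ Odd x ∧ m ∣ x ^ 2 + M := by
  have hc : Nat.Coprime 2 m := Nat.coprime_two_left.2 hm
  have hodd : 2 ∣ x ^ 2 + M ↔ Odd x := by
    rw [← even_iff_two_dvd]
    simp [Nat.even_add, Nat.even_pow, Nat.not_even_iff_odd.2 hM]
  rw [← hodd]
  exact mul_dvd_iff_of_coprime hc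

/-- For odd `m`, every residue modulo `m` has exactly one odd lift modulo `2m`. -/
theorem card_filter_dvd_sq_add_eq_card_odd (M : ℕ) {m : ℕ} (hm : Odd m) :
    {y ∈ Finset.range m | m ∣ y ^ 2 + M}.card =
      {x ∈ Finset.range (2 * m) | Odd x ∧ m ∣ x ^ 2 + M}.card := by
  have hpos := hm.pos
  have hmod {a b : ℕ} (hab : a ≡ b [MOD m]) : m ∣ a ^ 2 + M ↔ m ∣ b ^ 2 + M :=
    ((hab.pow 2).add_right M).dvd_iff dvd_rfl
  refine Finset.card_bij' (fun y _ => if Odd y then y else y + m) (fun x _ => x % m) ?_ ?_ ?_ ?_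
  · intro y hy
    rw [Finset.mem_filter, Finset.mem_range] at hy ⊢
    split_ifs with h
    · exact ⟨by lia, h, hy.2⟩
    · exact ⟨by lia, (Nat.not_odd_iff_even.1 h).add_odd hm, (hmod (by simp [Nat.ModEq])).2 hy.2⟩
  · intro x hx
    rw [Finset.mem_filter, Finset.mem_range] at hx ⊢
    exact ⟨Nat.mod_lt _ hpos, (hmod (Nat.mod_modEq x m)).2 hx.2.2⟩
  · intro y hy
    rw [Finset.mem_filter, Finset.mem_range] at hy
    split_ifs <;> simp [Nat.mod_eq_of_lt hy.1]
  · intro x hx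
    rw [Finset.mem_filter, Finset.mem_range] at hx
    rcases lt_or_ge x m with h | h
    · rw [Nat.mod_eq_of_lt h, if_pos hx.2.1]
    · have hs : x % m = x - m := by
        rw [Nat.mod_eq_sub_mod h, Nat.mod_eq_of_lt (by lia)]
      have hne : ¬ Odd (x - m) := Nat.not_odd_iff_even.2 (Nat.Odd.sub_odd hx.2.1 hm)
      rw [hs, if_neg hne]
      lia

/-- For `M ≡ 3 (mod 4)` and `n` squarefree coprime to `M`,
`r(-4M, n) = r(-M, n_odd)` where `n_odd = ordCompl[2] n` is the odd part of `n`. -/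
theorem r_neg_four_M (M : ℕ) (hM : 0 < M) (hM4 : M % 4 = 3)
    (n : ℕ) (hn : 0 < n) (hsf : Squarefree n) (hcop : Nat.Coprime M n) :
    r (-(4 * M) : ℤ) n = r (-(M : ℤ)) (ordCompl[2] n) := by
  have hn0 := hn.ne'
  have hm : Odd (ordCompl[2] n) :=
    Nat.coprime_two_left.1 (Nat.coprime_ordCompl Nat.prime_two hn0)
  have hM2 : Odd M := Nat.odd_iff.2 (by lia)
  rw [r_neg_four_mul_natCast, r_neg_natCast]
  simp only [four_mul_dvd_sq_add_iff hM4 hm]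
  have hfac := Nat.ordProj_mul_ordCompl_eq_self n 2
  generalize ordCompl[2] n = m at hm hfac ⊢
  have hle : n.factorization 2 ≤ 1 := hsf.natFactorization_le_one 2
  obtain h | h : n.factorization 2 = 0 ∨ n.factorization 2 = 1 := by lia
  · rw [h, pow_zero, one_mul] at hfac
    rw [← hfac]
    exact card_filter_dvd_sq_add_eq_card_odd M hm
  · rw [h, pow_one] at hfac
    rw [← hfac]
    simp only [two_mul_dvd_sq_add_iff hM2 hm]
end

section
/- Let M > 2 be a squarefree positive integer with M ≡ 1 or 2 (mod 4). Then the class number of the imaginary quadratic field ℚ(√−M) is strictly greater than 1. -/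
theorem exists_rat_coords_of_sq_eq_neg {K : Type*} [Field K] [NumberField K]
    (hdeg : Module.finrank ℚ K = 2) {M : ℕ} (hM : 0 < M) {α : K} (hα : α ^ 2 = -(M : K))
    (u : K) :
    ∃ x y : ℚ, u = algebraMap ℚ K x + algebraMap ℚ K y * α ∧
      Algebra.norm ℚ u = x ^ 2 + M * y ^ 2 ∧ Algebra.trace ℚ K u = 2 * x := by
  have hM' : (0 : ℚ) < M := by exact_mod_cast hM
  have hli : LinearIndependent ℚ ![(1 : K), α] := by
    rw [LinearIndependent.pair_iff]
    intro s t h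
    simp only [Algebra.smul_def, mul_one] at h
    have h2 : algebraMap ℚ K (s ^ 2 + M * t ^ 2) = 0 := by
      simp only [map_add, map_mul, map_pow, map_natCast]
      linear_combination (algebraMap ℚ K s - algebraMap ℚ K t * α) * h +
        (algebraMap ℚ K t) ^ 2 * hα
    have h3 : s ^ 2 + M * t ^ 2 = 0 := by simpa only [map_eq_zero] using h2
    have ht : t = 0 := by
      by_contra ht
      have := mul_pos hM' (pow_pos (abs_pos.mpr ht) 2)
      rw [sq_abs] at this
      nlinarith [sq_nonneg s]
    subst ht
    exact ⟨by simpa using h3, rfl⟩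
  let b := basisOfLinearIndependentOfCardEqFinrank hli (by simp [hdeg])
  have hb0 : b 0 = 1 := by simp [b]
  have hb1 : b 1 = α := by simp [b]
  have hu : u = algebraMap ℚ K (b.repr u 0) + algebraMap ℚ K (b.repr u 1) * α := by
    conv_lhs => rw [← b.sum_repr u]
    simp [Fin.sum_univ_two, hb0, hb1, Algebra.smul_def]
  generalize b.repr u 0 = x at hu
  generalize b.repr u 1 = y at hu
  have hmat : Algebra.leftMulMatrix b u = !![x, -(M * y); y, x] := by
    have key0 : u * b 0 = x • b 0 + y • b 1 := by
      rw [hb0, hb1, hu]; simp [Algebra.smul_def]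
    have key1 : u * b 1 = (-(M * y)) • b 0 + x • b 1 := by
      rw [hb0, hb1, hu]
      simp only [Algebra.smul_def, map_neg, map_mul, map_natCast]
      linear_combination (algebraMap ℚ K y) * hα
    ext i j
    rw [Algebra.leftMulMatrix_eq_repr_mul]
    fin_cases j
    · simp only [Fin.zero_eta, key0]
      fin_cases i <;> simp
    · simp only [Fin.mk_one, key1]
      fin_cases i <;> simp
  refine ⟨x, y, hu, ?_, ?_⟩
  · rw [Algebra.norm_eq_matrix_det b, hmat, Matrix.det_fin_two_of]; ring
  · rw [Algebra.trace_eq_matrix_trace b, hmat, Matrix.trace_fin_two_of]; ring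

theorem Rat.exists_int_eq_of_squarefree_mul_sq {M : ℕ} (hsf : Squarefree M) {y : ℚ} {n : ℤ}
    (h : (M : ℚ) * y ^ 2 = n) : ∃ k : ℤ, y = k := by
  have h1 : (M : ℤ) * y.num ^ 2 = n * (y.den : ℤ) ^ 2 := by
    have h2 : (M : ℚ) * y.num ^ 2 = n * (y.den : ℚ) ^ 2 := by
      rw [← h, ← Rat.mul_den_eq_num y]
      ring
    exact_mod_cast h2
  have hcop : IsCoprime ((y.den : ℤ) ^ 2) (y.num ^ 2) := by
    refine IsCoprime.pow (Int.isCoprime_iff_gcd_eq_one.mpr ?_)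
    simpa [Int.gcd] using y.reduced.symm
  have h3 : (y.den : ℤ) ^ 2 ∣ M := hcop.dvd_of_dvd_mul_right ⟨n, by rw [h1]; ring⟩
  have h4 : y.den * y.den ∣ M := by
    rw [← sq]; exact_mod_cast h3
  have h5 : y.den = 1 := Nat.isUnit_iff.mp (hsf _ h4)
  exact ⟨y.num, ((Rat.den_eq_one_iff y).mp h5).symm⟩

theorem norm_ringOfIntegers_eq_sq_add_mul_sq {K : Type*} [Field K] [NumberField K]
    (hdeg : Module.finrank ℚ K = 2) {M : ℕ} (hM : 0 < M) (hsf : Squarefree M)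
    {α : K} (hα : α ^ 2 = -(M : K)) (u : NumberField.RingOfIntegers K) :
    ∃ a b : ℤ, a ^ 2 + M * b ^ 2 = 4 * Algebra.norm ℤ u := by
  obtain ⟨x, y, -, hn, ht⟩ := exists_rat_coords_of_sq_eq_neg hdeg hM hα (u : K)
  rw [← Algebra.coe_norm_int] at hn
  rw [← Algebra.coe_trace_int] at ht
  obtain ⟨b, hb⟩ := Rat.exists_int_eq_of_squarefree_mul_sq hsf (y := 2 * y)
    (n := 4 * Algebra.norm ℤ u - (Algebra.trace ℤ _ u) ^ 2) (by
      push_cast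
      rw [hn, ht]
      ring)
  refine ⟨Algebra.trace ℤ _ u, b, ?_⟩
  have : ((Algebra.trace ℤ _ u : ℤ) : ℚ) ^ 2 + M * (b : ℚ) ^ 2 = 4 * (Algebra.norm ℤ u : ℤ) := by
    rw [← hb, hn, ht]
    ring
  exact_mod_cast this

theorem sq_add_mul_sq_ne_eight {M : ℕ} (hM : 2 < M) (hM4 : M % 4 = 1 ∨ M % 4 = 2) (a b : ℤ) :
    a ^ 2 + M * b ^ 2 ≠ 8 := by
  intro h
  have hM5 : (5 : ℤ) ≤ M := by omega
  have hb1 : b ≤ 1 := by nlinarith [sq_nonneg a]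
  have hb2 : -1 ≤ b := by nlinarith [sq_nonneg a]
  have ha1 : a ≤ 2 := by nlinarith [mul_nonneg (by omega : (0 : ℤ) ≤ M) (sq_nonneg b)]
  have ha2 : -2 ≤ a := by nlinarith [mul_nonneg (by omega : (0 : ℤ) ≤ M) (sq_nonneg b)]
  interval_cases b <;> interval_cases a <;> omega

/-- Let `M > 2` be squarefree with `M ≡ 1` or `2 (mod 4)`.  Then the
class number of the imaginary quadratic field `ℚ(√-M)` (formalized as any number field
`K` of degree `2` over `ℚ` containing a square root of `-M`) is strictly greater
than `1`. -/
theorem classNumber_gt_one (M : ℕ) (hM : 2 < M) (hsf : Squarefree M)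
    (hM4 : M % 4 = 1 ∨ M % 4 = 2)
    (K : Type*) [Field K] [NumberField K] (hdeg : Module.finrank ℚ K = 2)
    (α : K) (hα : α ^ 2 = -(M : K)) :
    1 < NumberField.classNumber K := by
  have hpos : 0 < NumberField.classNumber K := Fintype.card_pos
  by_contra hle
  have hone : NumberField.classNumber K = 1 := by omega
  have : IsPrincipalIdealRing (NumberField.RingOfIntegers K) :=
    NumberField.classNumber_eq_one_iff.mp hone
  have hM0 : 0 < M := by omega
  have norm_nonneg (u : NumberField.RingOfIntegers K) : 0 ≤ Algebra.norm ℤ u := by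
    obtain ⟨a, b, h⟩ := norm_ringOfIntegers_eq_sq_add_mul_sq hdeg hM0 hsf hα u
    have : (0 : ℤ) ≤ a ^ 2 + M * b ^ 2 := by positivity
    omega
  have norm_two : Algebra.norm ℤ (2 : NumberField.RingOfIntegers K) = 4 := by
    have := Algebra.norm_algebraMap (S := NumberField.RingOfIntegers K) (2 : ℤ)
    rw [NumberField.RingOfIntegers.rank, hdeg] at this
    simpa using this
  have unit_iff (u : NumberField.RingOfIntegers K) : IsUnit u ↔ Algebra.norm ℤ u = 1 := by
    rw [NumberField.isUnit_iff_norm, RingOfIntegers.coe_norm, ← Algebra.coe_norm_int,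
      abs_of_nonneg (by exact_mod_cast norm_nonneg u)]
    norm_cast
  have hirr : Irreducible (2 : NumberField.RingOfIntegers K) := by
    refine ⟨fun h => ?_, fun u v huv => ?_⟩
    · rw [unit_iff, norm_two] at h
      omega
    · have hmul : Algebra.norm ℤ u * Algebra.norm ℤ v = 4 := by
        rw [← map_mul, ← huv, norm_two]
      rw [unit_iff, unit_iff]
      have hne : Algebra.norm ℤ u ≠ 2 := fun h2 => by
        obtain ⟨a, b, h⟩ := norm_ringOfIntegers_eq_sq_add_mul_sq hdeg hM0 hsf hα u
        exact sq_add_mul_sq_ne_eight hM hM4 a b (by rw [h, h2]; rfl)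
      have hu := norm_nonneg u
      have hv := norm_nonneg v
      generalize Algebra.norm ℤ u = m at *
      generalize Algebra.norm ℤ v = n at *
      have : m ≤ 4 := Int.le_of_dvd (by norm_num) ⟨n, hmul.symm⟩
      interval_cases m <;> omega
  have hprime := hirr.prime
  have hαint : α ∈ integralClosure ℤ K := by
    rw [mem_integralClosure_iff]
    refine IsIntegral.of_pow (n := 2) (by norm_num) ?_
    rw [hα]
    exact (isIntegral_natCast M).neg
  obtain ⟨ω, hω⟩ : ∃ ω : NumberField.RingOfIntegers K,
      ω ^ 2 = -(M : NumberField.RingOfIntegers K) := by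
    obtain ⟨ω, hω⟩ : ∃ ω, algebraMap (NumberField.RingOfIntegers K) K ω = α :=
      ⟨⟨α, hαint⟩, rfl⟩
    refine ⟨ω, NumberField.RingOfIntegers.coe_injective ?_⟩
    rw [map_pow, map_neg, map_natCast, hω, hα]
  obtain ⟨c, k, hck⟩ : ∃ c k : ℤ, c ^ 2 + M = 4 * k + 2 := by
    rcases hM4 with h | h
    · exact ⟨1, M / 4, by omega⟩
    · exact ⟨0, M / 4, by omega⟩
  have hck' : (c : NumberField.RingOfIntegers K) ^ 2 + M = 4 * k + 2 := by exact_mod_cast hck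
  have two_ne : (2 : NumberField.RingOfIntegers K) ≠ 0 := hprime.ne_zero
  have not_dvd (z : NumberField.RingOfIntegers K)
      (hz : z ^ 2 = -(M : NumberField.RingOfIntegers K)) : ¬ 2 ∣ c + z := by
    rintro ⟨t, ht⟩
    refine hprime.not_isUnit (IsUnit.of_mul_eq_one (c * t - t ^ 2 - k) ?_)
    apply mul_left_cancel₀ two_ne
    linear_combination (-c + z + 2 * t) * ht - hz + hck'
  have hdvd : 2 ∣ (c + ω) * (c + -ω) :=
    ⟨2 * k + 1, by linear_combination hck' - hω⟩
  rcases hprime.dvd_or_dvd hdvd with h | h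
  · exact not_dvd ω hω h
  · exact not_dvd (-ω) (by rw [neg_sq, hω]) h
end
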